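/- arXiv:1511.06071 — 2 statements merged into one kernel-verified Lean document; each statement's English description precedes it below -/
import Mathlib

section
/- Classical reverse Shannon theorem, achievability: Let N be a discrete memoryless channel from finite alphabet X to finite alphabet Y with Shannon capacity C(N). For every δ > 0 and ε > 0 and all sufficiently large m, there exist a finite randomness set K, a finite message set M with |M| ≤ 2^{m(C(N)+δ)}, and for each k ∈ K a stochastic encoder E_k (a conditional pmf on M given x^m ∈ X^m) and a stochastic decoder D_k (a conditional pmf on Y^m given j ∈ M), such that for every x^m ∈ X^m the simulated output distribution Ñ(y^m|x^m) = (1/|K|) Σ_{k∈K} Σ_{j∈M} E_k(j|x^m) D_k(y^m|j) satisfies (1/2) Σ_{y^m} |Ñ(y^m|x^m) − Π_{i=1}^m N(y_i|x_i)| ≤ ε. -/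
open scoped BigOperators

/-- Shannon entropy (base 2) of a pmf on a finite set. -/
noncomputable def shEnt {S : Type*} [Fintype S] (p : S → ℝ) : ℝ :=
  ∑ s, -(p s * Real.logb 2 (p s))

/-- Mutual information `I(X;Y)` computed from a joint pmf on `X × Y`. -/
noncomputable def mutInfo {X Y : Type*} [Fintype X] [Fintype Y] (P : X × Y → ℝ) : ℝ :=
  shEnt (fun x => ∑ y, P (x, y)) + shEnt (fun y => ∑ x, P (x, y)) - shEnt P

/-- Shannon capacity of a discrete memoryless channel `N(y|x)`:
the supremum over input pmfs `p` of the mutual information of the joint pmf `p(x)N(y|x)`. -/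
noncomputable def capacity {X Y : Type*} [Fintype X] [Fintype Y] (N : X → Y → ℝ) : ℝ :=
  sSup {c : ℝ | ∃ p : X → ℝ, (∀ x, 0 ≤ p x) ∧ (∑ x, p x = 1) ∧
    c = mutInfo (fun z : X × Y => p z.1 * N z.1 z.2)}

namespace CRST

lemma tv_le {B : Type*} [Fintype B] (P Q r : B → ℝ) (hP : ∑ b, P b = 1) (hQ : ∑ b, Q b = 1)
    (h1 : ∀ b, r b ≤ P b) (h2 : ∀ b, r b ≤ Q b) :
    (1/2) * ∑ b, |P b - Q b| ≤ 1 - ∑ b, r b := by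
  have : ∑ b, |P b - Q b| ≤ ∑ b, (P b + Q b - 2 * r b) := by
    apply Finset.sum_le_sum
    intro b _
    rw [abs_le]
    constructor <;> linarith [h1 b, h2 b]
  rw [Finset.sum_sub_distrib, Finset.sum_add_distrib, ← Finset.mul_sum, hP, hQ] at this
  linarith

/-- probability of first acceptance at position `j` -/
noncomputable def fa {S : Type*} {L : ℕ} (a : S → ℝ) (k : Fin L → S) (j : Fin L) : ℝ :=
  a (k j) * ∏ i ∈ Finset.univ.filter (fun i => i < j), (1 - a (k i))

/-- the rejection sampling encoder -/
noncomputable def enc {S : Type*} {L : ℕ} (a : S → ℝ) (k : Fin L → S) (j : Fin L) : ℝ :=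
  fa a k j + if (j : ℕ) = 0 then ∏ i, (1 - a (k i)) else 0

lemma fa_le_enc {S : Type*} {L : ℕ} (a : S → ℝ) (h1 : ∀ s, a s ≤ 1)
    (k : Fin L → S) (j : Fin L) : fa a k j ≤ enc a k j := by
  unfold enc
  have : 0 ≤ ∏ i, (1 - a (k i)) := Finset.prod_nonneg (fun i _ => by linarith [h1 (k i)])
  split_ifs <;> linarith

lemma fa_nonneg {S : Type*} {L : ℕ} (a : S → ℝ) (h0 : ∀ s, 0 ≤ a s) (h1 : ∀ s, a s ≤ 1)
    (k : Fin L → S) (j : Fin L) : 0 ≤ fa a k j :=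
  mul_nonneg (h0 _) (Finset.prod_nonneg (fun i _ => by linarith [h1 (k i)]))

lemma enc_sum {S : Type*} {L : ℕ} (hL : 0 < L) (a : S → ℝ) (k : Fin L → S) :
    ∑ j, enc a k j = 1 := by
  unfold enc
  rw [Finset.sum_add_distrib]
  have h := Finset.prod_one_sub_ordered (Finset.univ : Finset (Fin L)) (fun i => a (k i))
  have h2 : ∑ j : Fin L, (if (j : ℕ) = 0 then ∏ i, (1 - a (k i)) else 0)
      = ∏ i, (1 - a (k i)) := by
    rw [Finset.sum_eq_single (⟨0, hL⟩ : Fin L)]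
    · simp
    · intro b _ hb
      rw [if_neg]
      intro h; apply hb; ext; simpa using h
    · simp
  rw [h2, h]
  unfold fa
  ring

lemma avg_fa {S : Type*} [Fintype S] [Nonempty S] {L : ℕ} (a g : S → ℝ) (j : Fin L) :
    ((Fintype.card (Fin L → S) : ℝ))⁻¹ * ∑ k : Fin L → S, fa a k j * g (k j)
    = ((∑ s, a s * g s) / Fintype.card S) * (1 - (∑ s, a s) / Fintype.card S) ^ (j : ℕ) := by
  classical
  have hS : (Fintype.card S : ℝ) ≠ 0 := by exact_mod_cast Fintype.card_ne_zero
  let h : Fin L → S → ℝ := fun i s => if i < j then 1 - a s else if i = j then a s * g s else 1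
  have e1 : ∀ k : Fin L → S, fa a k j * g (k j) = ∏ i, h i (k i) := by
    intro k
    have : ∀ i, h i (k i) = (if i < j then 1 - a (k i) else 1) *
        (if i = j then a (k j) * g (k j) else 1) := by
      intro i
      by_cases hij : i < j
      · simp [h, hij, hij.ne]
      · by_cases h' : i = j
        · subst h'; simp [h]
        · simp [h, hij, h']
    rw [Finset.prod_congr rfl (fun i _ => this i), Finset.prod_mul_distrib,
      Finset.prod_ite_eq' , ← Finset.prod_filter]
    simp [fa]; ring
  have e2 : ∑ k : Fin L → S, ∏ i, h i (k i) = ∏ i, ∑ s, h i s := by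
    rw [Finset.prod_univ_sum]; simp
  rw [Finset.sum_congr rfl (fun k _ => e1 k), e2]
  have e3 : (Fintype.card (Fin L → S) : ℝ)⁻¹ = ∏ i : Fin L, (Fintype.card S : ℝ)⁻¹ := by
    simp
  rw [e3, ← Finset.prod_mul_distrib]
  have e4 : ∀ i, (Fintype.card S : ℝ)⁻¹ * ∑ s, h i s
      = (if i < j then 1 - (∑ s, a s) / Fintype.card S else 1) *
        (if i = j then (∑ s, a s * g s) / Fintype.card S else 1) := by
    intro i
    by_cases hij : i < j
    · simp [h, hij, hij.ne, Finset.sum_sub_distrib]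
      field_simp
    · by_cases h' : i = j
      · subst h'; simp [h]; field_simp
      · simp [h, hij, h']
  rw [Finset.prod_congr rfl (fun i _ => e4 i), Finset.prod_mul_distrib,
      Finset.prod_ite_eq' , ← Finset.prod_filter]
  have : (Finset.univ.filter (fun i => i < j)).card = (j : ℕ) := by
    have : (Finset.univ.filter (fun i => i < j)) = Finset.Iio j := by ext; simp
    rw [this, Fin.card_Iio]
  simp [this]; ring

lemma avg_enc {S : Type*} [Fintype S] [Nonempty S] {L : ℕ} (a g : S → ℝ)
    (h1 : ∀ s, a s ≤ 1) (hg : ∀ s, 0 ≤ g s) :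
    ((∑ s, a s * g s) / Fintype.card S) *
      ∑ j ∈ Finset.range L, (1 - (∑ s, a s) / Fintype.card S) ^ j ≤
    ((Fintype.card (Fin L → S) : ℝ))⁻¹ * ∑ k : Fin L → S, ∑ j, enc a k j * g (k j) := by
  rw [Finset.sum_comm, Finset.mul_sum, Finset.mul_sum, Finset.sum_range]
  apply Finset.sum_le_sum
  intro j _
  rw [← avg_fa]
  gcongr with k
  · exact hg _
  · exact fa_le_enc a h1 k j

lemma oneshot {A B : Type} [Fintype B] [Nonempty A] (W : A → B → ℝ)
    (hW0 : ∀ x y, 0 ≤ W x y) (hW1 : ∀ x, ∑ y, W x y = 1)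
    (q : B → ℝ) (hq0 : ∀ y, 0 ≤ q y) (hq1 : ∑ y, q y ≤ 1) (lam e1 R : ℝ) (hlam : 0 < lam)
    (he : e1 ≤ 1/2) (hR : 0 < R)
    (bad : A → B → Prop)
    (hgood : ∀ x y, ¬ bad x y → W x y ≤ lam * q y)
    (hbad : ∀ x, (by classical exact ∑ y, if bad x y then W x y else 0) ≤ e1) :
    ∃ (K M : Type) (_ : Fintype K) (_ : Fintype M),
        0 < Fintype.card K ∧
        (Fintype.card M : ℝ) ≤ 2 * lam * (R + 1) ∧
        ∃ (E : K → A → M → ℝ) (D : K → M → B → ℝ),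
          (∀ k xs j, 0 ≤ E k xs j) ∧ (∀ k xs, ∑ j, E k xs j = 1) ∧
          (∀ k j ys, 0 ≤ D k j ys) ∧ (∀ k j, ∑ ys, D k j ys = 1) ∧
          ∀ xs : A,
            (1/2) * ∑ ys : B,
              |((Fintype.card K : ℝ)⁻¹ * ∑ k, ∑ j, E k xs j * D k j ys)
                - W xs ys| ≤ e1 + Real.exp (-R / 2) := by
  classical
  have hBne : Nonempty B := by
    by_contra h
    rw [not_nonempty_iff] at h
    have := hW1 (Classical.arbitrary A)
    simp at this
  set n : ℝ := (Fintype.card B : ℝ) with hn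
  have hnpos : 0 < n := by rw [hn]; exact_mod_cast Fintype.card_pos
  let c : B → ℕ := fun b => ⌊n * q b⌋₊ + 1
  let S := Σ b : B, Fin (c b)
  have : Nonempty S := ⟨⟨Classical.arbitrary B, ⟨0, Nat.succ_pos _⟩⟩⟩
  have hc0 : ∀ b, (0:ℝ) < c b := fun b => by simp only [c]; positivity
  have hcq : ∀ b, n * q b ≤ c b := fun b => by
    simp only [c]; push_cast; exact (Nat.lt_floor_add_one _).le
  have hScard : (Fintype.card S : ℝ) = ∑ b, (c b : ℝ) := by simp [S]
  have hSle : (Fintype.card S : ℝ) ≤ 2 * n := by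
    rw [hScard]
    calc ∑ b, (c b : ℝ) ≤ ∑ b, (n * q b + 1) := by
          apply Finset.sum_le_sum; intro b _
          simp only [c]; push_cast
          have := Nat.floor_le (mul_nonneg hnpos.le (hq0 b))
          linarith
      _ = n * ∑ b, q b + n := by rw [Finset.sum_add_distrib, ← Finset.mul_sum]; simp [hn]
      _ ≤ 2 * n := by nlinarith
  have hSpos : (0:ℝ) < Fintype.card S := by exact_mod_cast Fintype.card_pos
  set s₀ : ℝ := (Fintype.card S : ℝ) with hs0
  -- good part
  let W' : A → B → ℝ := fun x y => if bad x y then 0 else W x y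
  have hW'0 : ∀ x y, 0 ≤ W' x y := fun x y => by
    simp only [W']; split_ifs; exacts [le_rfl, hW0 x y]
  have hW'le : ∀ x y, W' x y ≤ W x y := fun x y => by
    simp only [W']; split_ifs; exacts [hW0 x y, le_rfl]
  have hW'q : ∀ x y, W' x y ≤ lam * q y := fun x y => by
    simp only [W']; split_ifs with h
    exacts [mul_nonneg hlam.le (hq0 y), hgood x y h]
  let β : A → ℝ := fun x => ∑ y, W' x y
  have hβ1 : ∀ x, β x ≤ 1 := fun x => by
    rw [← hW1 x]; exact Finset.sum_le_sum (fun y _ => hW'le x y)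
  have hβe : ∀ x, 1 - e1 ≤ β x := fun x => by
    have h := hbad x
    have : β x = ∑ y, W x y - ∑ y, if bad x y then W x y else 0 := by
      rw [← Finset.sum_sub_distrib]
      apply Finset.sum_congr rfl; intro y _
      simp only [W']; split_ifs <;> simp
    rw [this, hW1]; linarith
  have hlamhalf : 1 ≤ 2 * lam := by
    have x := Classical.arbitrary A
    have h1 : β x ≤ lam * ∑ y, q y := by
      rw [Finset.mul_sum]; exact Finset.sum_le_sum (fun y _ => hW'q x y)
    have := hβe x
    nlinarith
  set l2 := 2 * lam with hl2
  have hl2p : 0 < l2 := by positivity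
  let a : A → S → ℝ := fun x s => W' x s.1 * s₀ / (l2 * c s.1)
  have ha0 : ∀ x s, 0 ≤ a x s := fun x s =>
    div_nonneg (mul_nonneg (hW'0 _ _) hSpos.le) (mul_nonneg hl2p.le (hc0 _).le)
  have ha1 : ∀ x s, a x s ≤ 1 := fun x s => by
    simp only [a]
    rw [div_le_one (mul_pos hl2p (hc0 _))]
    calc W' x s.1 * s₀ ≤ (lam * q s.1) * (2 * n) :=
          mul_le_mul (hW'q _ _) hSle hSpos.le (mul_nonneg hlam.le (hq0 _))
      _ = l2 * (n * q s.1) := by rw [hl2]; ring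
      _ ≤ _ := by gcongr; exact hcq _
  have hag : ∀ x (y : B), (∑ s : S, a x s * (if s.1 = y then (1:ℝ) else 0)) / s₀ = W' x y / l2 := by
    intro x y
    rw [Fintype.sum_sigma, Finset.sum_eq_single y]
    · simp only [a, if_true, mul_one, Finset.sum_const, Finset.card_univ, Fintype.card_fin,
        nsmul_eq_mul]
      have := (hc0 y).ne'
      field_simp
    · intro b _ hb
      simp [hb]
    · simp
  have hasum : ∀ x, (∑ s : S, a x s) / s₀ = β x / l2 := by
    intro x
    have : ∑ s : S, a x s = ∑ y, ∑ s : S, a x s * (if s.1 = y then (1:ℝ) else 0) := by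
      rw [Finset.sum_comm]; apply Finset.sum_congr rfl; intro s _; simp
    rw [this, Finset.sum_div, Finset.sum_congr rfl (fun y _ => hag x y), ← Finset.sum_div]
  let L : ℕ := ⌈l2 * R⌉₊
  have hL : 0 < L := Nat.ceil_pos.mpr (by positivity)
  have hLge : l2 * R ≤ L := Nat.le_ceil _
  refine ⟨Fin L → S, Fin L, inferInstance, inferInstance, Fintype.card_pos, ?_,
    fun k x j => enc (a x) k j, fun k j y => if (k j).1 = y then 1 else 0, ?_, ?_, ?_, ?_, ?_⟩
  · rw [Fintype.card_fin]
    have := Nat.ceil_lt_add_one (a := l2 * R) (by positivity)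
    simp only [L]; nlinarith
  · intro k x j
    exact (fa_nonneg (a x) (ha0 x) (ha1 x) k j).trans (fa_le_enc _ (ha1 x) k j)
  · intro k x; exact enc_sum hL _ _
  · intro k j y; dsimp only; split_ifs <;> norm_num
  · intro k j; simp
  · intro x
    have hβpos : 0 < β x := by linarith [hβe x]
    set α := β x / l2 with hα
    have hαpos : 0 < α := by positivity
    have hαle : α ≤ 1 := by rw [hα, div_le_one hl2p]; linarith [hβ1 x]
    set t := (1 - α) ^ L with ht
    have ht0 : 0 ≤ t := pow_nonneg (by linarith) _
    have ht1 : t ≤ 1 := pow_le_one₀ (by linarith) (by linarith)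
    have hte : t ≤ Real.exp (-R/2) := by
      calc t ≤ (Real.exp (-α)) ^ L := by
            apply pow_le_pow_left₀ (by linarith)
            have := Real.add_one_le_exp (-α); linarith
        _ = Real.exp (-(L * α)) := by rw [← Real.exp_nat_mul]; ring_nf
        _ ≤ _ := by
            apply Real.exp_le_exp.mpr
            have : (l2 * R) * α ≤ L * α := by gcongr
            have h2 : (l2 * R) * α = R * β x := by rw [hα]; field_simp
            have h3 : 1/2 ≤ β x := by linarith [hβe x]
            nlinarith
    have key := tv_le
      (fun ys => (Fintype.card (Fin L → S) : ℝ)⁻¹ * ∑ k : Fin L → S, ∑ j,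
        enc (a x) k j * (if (k j).1 = ys then 1 else 0))
      (W x) (fun y => W' x y * (1 - t)) ?_ (hW1 x) ?_ ?_
    · refine key.trans ?_
      rw [← Finset.sum_mul]
      change 1 - β x * (1 - t) ≤ _
      have := hβe x
      have := hβ1 x
      nlinarith
    · rw [← Finset.mul_sum, Finset.sum_comm]
      have : ∀ k : Fin L → S, ∑ y : B, ∑ j, enc (a x) k j * (if (k j).1 = y then (1:ℝ) else 0) = 1 := by
        intro k
        rw [Finset.sum_comm]
        refine Eq.trans ?_ (enc_sum hL (a x) k)
        apply Finset.sum_congr rfl; intro j _; simp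
      rw [Finset.sum_congr rfl (fun k _ => this k)]
      simp
    · intro y
      have h := avg_enc (L := L) (a x) (fun s => if s.1 = y then (1:ℝ) else 0) (ha1 x)
        (fun s => by split_ifs <;> norm_num)
      rw [← hs0, hag, hasum, ← hα] at h
      refine le_trans ?_ h
      have hg : α * ∑ j ∈ Finset.range L, (1 - α) ^ j = 1 - t := by
        have := mul_neg_geom_sum (1 - α) L
        rw [ht, ← this]; ring
      have hg' : ∑ j ∈ Finset.range L, (1 - α) ^ j = (1 - t) / α := by
        rw [← hg]; field_simp
      rw [hg', hα]
      have : W' x y / l2 * ((1 - t) / (β x / l2)) = W' x y * (1 - t) / β x := by field_simp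
      rw [this, le_div_iff₀ hβpos]
      have h0 : 0 ≤ W' x y * (1 - t) := mul_nonneg (hW'0 _ _) (by linarith)
      nlinarith [hβ1 x]
    · intro y
      have := hW'le x y
      have := hW'0 x y
      nlinarith

lemma second_moment {Y : Type*} [Fintype Y] : ∀ (m : ℕ) (w g : Fin m → Y → ℝ)
    (_ : ∀ i, ∑ y, w i y = 1) (_ : ∀ i, ∑ y, w i y * g i y = 0) (c : ℝ),
    ∑ ys : Fin m → Y, (∏ i, w i (ys i)) * (c + ∑ i, g i (ys i)) ^ 2
      = c ^ 2 + ∑ i, ∑ y, w i y * (g i y) ^ 2 := by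
  intro m
  induction m with
  | zero => intro w g _ _ c; simp
  | succ m ih =>
    intro w g hw hg c
    rw [← Equiv.sum_comp (Fin.consEquiv (fun _ => Y)), Fintype.sum_prod_type]
    have h1 : ∀ y : Y, ∑ ys : Fin m → Y,
        (∏ i, w i ((Fin.consEquiv (fun _ => Y)) (y, ys) i)) *
          (c + ∑ i, g i ((Fin.consEquiv (fun _ => Y)) (y, ys) i)) ^ 2
        = w 0 y * ((c + g 0 y) ^ 2 + ∑ i : Fin m, ∑ y, w i.succ y * (g i.succ y) ^ 2) := by
      intro y
      rw [← ih (fun i => w i.succ) (fun i => g i.succ) (fun i => hw _) (fun i => hg _) (c + g 0 y),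
        Finset.mul_sum]
      apply Finset.sum_congr rfl; intro ys _
      simp [Fin.consEquiv, Fin.prod_univ_succ, Fin.sum_univ_succ]
      ring
    rw [Finset.sum_congr rfl (fun y _ => h1 y), Fin.sum_univ_succ]
    set V := ∑ i : Fin m, ∑ y, w i.succ y * (g i.succ y) ^ 2
    have : ∀ y, w 0 y * ((c + g 0 y) ^ 2 + V)
        = (c ^ 2 + V) * w 0 y + 2 * c * (w 0 y * g 0 y) + w 0 y * (g 0 y) ^ 2 := by
      intro y; ring
    rw [Finset.sum_congr rfl (fun y _ => this y), Finset.sum_add_distrib, Finset.sum_add_distrib,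
      ← Finset.mul_sum, ← Finset.mul_sum, hw, hg]
    ring

lemma mul_log_sq_le {u : ℝ} (h0 : 0 ≤ u) (h1 : u ≤ 1) : u * (Real.log u) ^ 2 ≤ 4 := by
  rcases h0.eq_or_lt with rfl | hp
  · simp
  have hs : 0 < √u := Real.sqrt_pos.mpr hp
  have h2 : Real.log u = 2 * Real.log (√u) := by rw [Real.log_sqrt h0]; ring
  have h3 : Real.log (√u)⁻¹ ≤ (√u)⁻¹ := (Real.log_le_sub_one_of_pos (by positivity)).trans (by linarith)
  rw [Real.log_inv] at h3
  have h4 : Real.log (√u) ≤ 0 := Real.log_nonpos hs.le (Real.sqrt_le_one.mpr h1)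
  have h5 : (Real.log √u) ^ 2 ≤ ((√u)⁻¹) ^ 2 := by nlinarith
  have h6 : ((√u)⁻¹) ^ 2 = u⁻¹ := by rw [inv_pow, Real.sq_sqrt h0]
  rw [h6] at h5
  rw [h2]
  calc u * (2 * Real.log √u) ^ 2 = 4 * (u * (Real.log √u)^2) := by ring
    _ ≤ 4 * (u * u⁻¹) := by gcongr
    _ = 4 := by field_simp

section
variable {X Y : Type*} [Fintype X] [Fintype Y]

/-- output distribution -/
noncomputable def outp (N : X → Y → ℝ) (p : X → ℝ) (y : Y) : ℝ := ∑ x, p x * N x y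

/-- information density (nats) -/
noncomputable def dens (N : X → Y → ℝ) (p : X → ℝ) (x : X) (y : Y) : ℝ :=
  Real.log (N x y / outp N p y)

lemma outp_ge (N : X → Y → ℝ) (hN0 : ∀ x y, 0 ≤ N x y) (p : X → ℝ)
    (hp0 : ∀ x, 0 ≤ p x) (x : X) (y : Y) : p x * N x y ≤ outp N p y :=
  Finset.single_le_sum (f := fun x => p x * N x y)
    (fun x _ => mul_nonneg (hp0 x) (hN0 x y)) (Finset.mem_univ x)

lemma N_le_one (N : X → Y → ℝ) (hN0 : ∀ x y, 0 ≤ N x y) (hN1 : ∀ x, ∑ y, N x y = 1)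
     (x : X) (y : Y) : N x y ≤ 1 := by
  rw [← hN1 x]
  exact Finset.single_le_sum (f := fun y => N x y) (fun y _ => hN0 x y) (Finset.mem_univ y)

lemma outp_le_one (N : X → Y → ℝ) (hN0 : ∀ x y, 0 ≤ N x y) (hN1 : ∀ x, ∑ y, N x y = 1)
    (p : X → ℝ) (hp0 : ∀ x, 0 ≤ p x) (hp1 : ∑ x, p x = 1) (y : Y) : outp N p y ≤ 1 := by
  rw [← hp1]
  apply Finset.sum_le_sum
  intro x _
  have := N_le_one N hN0 hN1 x y
  nlinarith [hp0 x]

lemma sum_dens_sq (N : X → Y → ℝ) (hN0 : ∀ x y, 0 ≤ N x y) (hN1 : ∀ x, ∑ y, N x y = 1)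
    (p : X → ℝ) (hp0 : ∀ x, 0 ≤ p x) (hp1 : ∑ x, p x = 1) : ∑ x, p x * ∑ y, N x y * (dens N p x y) ^ 2
    ≤ 4 * (Fintype.card X + Fintype.card Y) := by
  have hp_le : ∀ x, p x ≤ 1 := fun x => by
    rw [← hp1]; exact Finset.single_le_sum (f := p) (fun x _ => hp0 x) (Finset.mem_univ x)
  have key : ∀ x y, p x * (N x y * (dens N p x y) ^ 2)
      ≤ p x * (N x y * (Real.log (N x y)) ^ 2) + (p x * (Real.log (p x)) ^ 2) * N x y := by
    intro x y
    rcases (hp0 x).eq_or_lt with h | hp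
    · simp [← h]
    rcases (hN0 x y).eq_or_lt with h | hN
    · simp [← h]
    have hq := outp_ge N hN0 p hp0 x y
    have hq1 := outp_le_one N hN0 hN1 p hp0 hp1 y
    have hqp : 0 < outp N p y := (mul_pos hp hN).trans_le hq
    have h1 : Real.log (N x y) ≤ dens N p x y := by
      unfold dens; rw [Real.log_div hN.ne' hqp.ne']
      linarith [Real.log_nonpos hqp.le hq1]
    have h2 : dens N p x y ≤ - Real.log (p x) := by
      unfold dens; rw [Real.log_div hN.ne' hqp.ne']
      have := Real.log_le_log (mul_pos hp hN) hq
      rw [Real.log_mul hp.ne' hN.ne'] at this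
      linarith
    have h3 : (dens N p x y) ^ 2 ≤ (Real.log (N x y)) ^ 2 + (Real.log (p x)) ^ 2 := by
      rcases le_total 0 (dens N p x y) with h | h
      · nlinarith [sq_nonneg (Real.log (N x y))]
      · nlinarith [sq_nonneg (Real.log (p x))]
    calc p x * (N x y * (dens N p x y) ^ 2)
        ≤ p x * (N x y * ((Real.log (N x y)) ^ 2 + (Real.log (p x)) ^ 2)) := by gcongr
      _ = _ := by ring
  calc ∑ x, p x * ∑ y, N x y * (dens N p x y) ^ 2
      ≤ ∑ x, (p x * (4 * Fintype.card Y) + 4) := by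
        apply Finset.sum_le_sum
        intro x _
        rw [Finset.mul_sum]
        calc ∑ y, p x * (N x y * (dens N p x y) ^ 2)
          ≤ ∑ y, (p x * (N x y * (Real.log (N x y)) ^ 2) + (p x * (Real.log (p x)) ^ 2) * N x y) :=
            Finset.sum_le_sum (fun y _ => key x y)
          _ = p x * ∑ y, (N x y * (Real.log (N x y)) ^ 2) + p x * (Real.log (p x)) ^ 2 := by
            rw [Finset.sum_add_distrib, ← Finset.mul_sum, ← Finset.mul_sum, hN1, mul_one]
          _ ≤ p x * ∑ _y : Y, 4 + 4 := by
            gcongr with y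
            · exact hp0 x
            · exact mul_log_sq_le (hN0 x y) (N_le_one N hN0 hN1 x y)
            · exact mul_log_sq_le (hp0 x) (hp_le x)
          _ = _ := by simp [mul_comm]
    _ = _ := by
      rw [Finset.sum_add_distrib, ← Finset.sum_mul, hp1]; simp; ring

lemma sum_dens (N : X → Y → ℝ) (hN0 : ∀ x y, 0 ≤ N x y) (hN1 : ∀ x, ∑ y, N x y = 1)
    (p : X → ℝ) (hp0 : ∀ x, 0 ≤ p x) : ∑ x, p x * ∑ y, N x y * dens N p x y
    = mutInfo (fun z : X × Y => p z.1 * N z.1 z.2) * Real.log 2 := by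
  have hl : Real.log 2 ≠ 0 := (Real.log_pos (by norm_num)).ne'
  have hlog : ∀ u : ℝ, -(u * Real.logb 2 u) * Real.log 2 = -(u * Real.log u) := by
    intro u; unfold Real.logb; field_simp
  unfold mutInfo shEnt
  rw [sub_mul, add_mul, Finset.sum_mul, Finset.sum_mul, Finset.sum_mul]
  simp only [hlog, Fintype.sum_prod_type]
  have e1 : ∀ x, ∑ y, p x * N x y = p x := fun x => by rw [← Finset.mul_sum, hN1, mul_one]
  simp only [e1]
  have e2 : ∀ y, ∑ x, p x * N x y = outp N p y := fun y => rfl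
  simp only [e2]
  have key : ∀ x y, p x * (N x y * dens N p x y) = -(p x * Real.log (p x)) * N x y
      - (p x * N x y) * Real.log (outp N p y) - -(p x * N x y * Real.log (p x * N x y)) := by
    intro x y
    rcases (hp0 x).eq_or_lt with h | hp
    · simp [← h]
    rcases (hN0 x y).eq_or_lt with h | hN
    · simp [← h]
    have hq := outp_ge N hN0 p hp0 x y
    have hqp : 0 < outp N p y := (mul_pos hp hN).trans_le hq
    unfold dens
    rw [Real.log_div hN.ne' hqp.ne', Real.log_mul hp.ne' hN.ne']
    ring
  simp only [Finset.mul_sum, key, Finset.sum_sub_distrib]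
  have e3 : ∑ x, ∑ y, -(p x * Real.log (p x)) * N x y = ∑ x, -(p x * Real.log (p x)) := by
    apply Finset.sum_congr rfl; intro x _; rw [← Finset.mul_sum, hN1, mul_one]
  have e4 : ∑ x, ∑ y, (p x * N x y) * Real.log (outp N p y)
      = ∑ y, outp N p y * Real.log (outp N p y) := by
    rw [Finset.sum_comm]
    apply Finset.sum_congr rfl; intro y _; rw [← Finset.sum_mul]; rfl
  rw [e3, e4]
  simp only [Finset.sum_neg_distrib]
  ring

end

lemma shEnt_le {S : Type*} [Fintype S] (p : S → ℝ) (h0 : ∀ s, 0 ≤ p s) (h1 : ∀ s, p s ≤ 1) :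
    0 ≤ shEnt p ∧ shEnt p ≤ Fintype.card S * (1 / Real.log 2) := by
  have hl : 0 < Real.log 2 := Real.log_pos (by norm_num)
  constructor
  · apply Finset.sum_nonneg
    intro s _
    have : Real.logb 2 (p s) ≤ 0 := Real.logb_nonpos (by norm_num) (h0 s) (h1 s)
    nlinarith [h0 s]
  · unfold shEnt
    calc _ ≤ ∑ _s : S, 1 / Real.log 2 := by
          apply Finset.sum_le_sum
          intro s _
          rcases (h0 s).eq_or_lt with h | hp
          · rw [← h]; simp; exact hl.le
          · unfold Real.logb
            have h3 := Real.log_le_sub_one_of_pos (inv_pos.mpr hp)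
            rw [Real.log_inv] at h3
            have : p s * (-Real.log (p s)) ≤ 1 := by
              calc p s * (-Real.log (p s)) ≤ p s * ((p s)⁻¹ - 1) := by gcongr
                _ = 1 - p s := by field_simp
                _ ≤ 1 := by linarith
            have e : -(p s * (Real.log (p s) / Real.log 2)) = (p s * (-Real.log (p s))) / Real.log 2 := by
              ring
            rw [e]; gcongr
      _ = _ := by simp

lemma mutInfo_le_capacity {X Y : Type*} [Fintype X] [Fintype Y] (N : X → Y → ℝ)
    (hN0 : ∀ x y, 0 ≤ N x y) (hN1 : ∀ x, ∑ y, N x y = 1)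
    (p : X → ℝ) (hp0 : ∀ x, 0 ≤ p x) (hp1 : ∑ x, p x = 1) :
    mutInfo (fun z : X × Y => p z.1 * N z.1 z.2) ≤ capacity N := by
  apply le_csSup
  · refine ⟨Fintype.card X * (1 / Real.log 2) + Fintype.card Y * (1 / Real.log 2), ?_⟩
    rintro c ⟨p, hp0, hp1, rfl⟩
    have hp_le : ∀ x, p x ≤ 1 := fun x => by
      rw [← hp1]; exact Finset.single_le_sum (f := p) (fun x _ => hp0 x) (Finset.mem_univ x)
    have e1 : ∀ x, ∑ y, p x * N x y = p x := fun x => by rw [← Finset.mul_sum, hN1, mul_one]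
    have h1 := shEnt_le p hp0 hp_le
    have h2 := shEnt_le (outp N p)
      (fun y => Finset.sum_nonneg (fun x _ => mul_nonneg (hp0 x) (hN0 x y)))
      (outp_le_one N hN0 hN1 p hp0 hp1)
    have h3 := shEnt_le (fun z : X × Y => p z.1 * N z.1 z.2)
      (fun z => mul_nonneg (hp0 _) (hN0 _ _))
      (fun z => mul_le_one₀ (hp_le _) (hN0 _ _) (N_le_one N hN0 hN1 _ _))
    unfold mutInfo
    simp only [e1]
    change shEnt p + shEnt (outp N p) - _ ≤ _
    linarith
  · exact ⟨p, hp0, hp1, rfl⟩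

lemma chebyshev {X Y : Type*} [Fintype X] [Fintype Y] (N : X → Y → ℝ)
    (hN0 : ∀ x y, 0 ≤ N x y) (hN1 : ∀ x, ∑ y, N x y = 1) {m : ℕ} (hm : 0 < m)
    (p : X → ℝ) (hp0 : ∀ x, 0 ≤ p x) (hp1 : ∑ x, p x = 1) (xs : Fin m → X)
    (hty : ∀ φ : X → ℝ, ∑ i, φ (xs i) = m * ∑ x, p x * φ x) (d : ℝ) (hd : 0 < d)
    (bad : (Fin m → Y) → Prop) [DecidablePred bad]
    (hbad : ∀ ys, bad ys → m * (capacity N * Real.log 2 + d) < ∑ i, dens N p (xs i) (ys i)) :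
    (∑ ys : Fin m → Y, if bad ys then ∏ i, N (xs i) (ys i) else 0)
      ≤ 4 * (Fintype.card X + Fintype.card Y) / (m * d ^ 2) := by
  have hmR : (0:ℝ) < m := by exact_mod_cast hm
  have hl : 0 < Real.log 2 := Real.log_pos (by norm_num)
  let μ : X → ℝ := fun x => ∑ y, N x y * dens N p x y
  have hmu : ∑ i, μ (xs i) ≤ m * (capacity N * Real.log 2) := by
    rw [hty μ, sum_dens N hN0 hN1 p hp0]
    gcongr
    exact mutInfo_le_capacity N hN0 hN1 p hp0 hp1
  have sm := second_moment m (fun i => N (xs i)) (fun i y => dens N p (xs i) y - μ (xs i))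
    (fun i => hN1 _) (fun i => by
      simp only [mul_sub, Finset.sum_sub_distrib, ← Finset.sum_mul, hN1]; simp [μ]) 0
  have hvar : ∀ x, ∑ y, N x y * (dens N p x y - μ x) ^ 2 ≤ ∑ y, N x y * (dens N p x y) ^ 2 := by
    intro x
    have : ∀ y, N x y * (dens N p x y - μ x) ^ 2 = N x y * (dens N p x y) ^ 2
        - 2 * μ x * (N x y * dens N p x y) + (μ x) ^ 2 * N x y := fun y => by ring
    simp only [this, Finset.sum_add_distrib, Finset.sum_sub_distrib, ← Finset.mul_sum, hN1]
    change _ - 2 * μ x * μ x + _ ≤ _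
    nlinarith [sq_nonneg (μ x)]
  have hV : ∑ i : Fin m, ∑ y, N (xs i) y * (dens N p (xs i) y - μ (xs i)) ^ 2
      ≤ m * (4 * (Fintype.card X + Fintype.card Y)) := by
    calc _ ≤ ∑ i : Fin m, ∑ y, N (xs i) y * (dens N p (xs i) y) ^ 2 :=
          Finset.sum_le_sum (fun i _ => hvar _)
      _ = m * ∑ x, p x * ∑ y, N x y * (dens N p x y) ^ 2 :=
          hty (fun x => ∑ y, N x y * (dens N p x y) ^ 2)
      _ ≤ _ := by gcongr; exact sum_dens_sq N hN0 hN1 p hp0 hp1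
  have h1 : (∑ ys : Fin m → Y, if bad ys then ∏ i, N (xs i) (ys i) else 0) * (m * d) ^ 2
      ≤ m * (4 * (Fintype.card X + Fintype.card Y)) := by
    refine le_trans ?_ hV
    simp only [ne_eq, OfNat.ofNat_ne_zero, not_false_eq_true, zero_pow, zero_add] at sm
    rw [← sm, Finset.sum_mul]
    apply Finset.sum_le_sum
    intro ys _
    have hpn : 0 ≤ ∏ i, N (xs i) (ys i) := Finset.prod_nonneg (fun i _ => hN0 _ _)
    split_ifs with h
    · apply mul_le_mul_of_nonneg_left _ hpn
      have := hbad ys h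
      apply pow_le_pow_left₀ (by positivity)
      rw [Finset.sum_sub_distrib]
      nlinarith
    · rw [zero_mul]; positivity
  rw [le_div_iff₀ (by positivity)]
  have : (∑ ys : Fin m → Y, if bad ys then ∏ i, N (xs i) (ys i) else 0) * (m * d ^ 2) * m
     ≤ (4 * (Fintype.card X + Fintype.card Y)) * m := by
    calc _ = _ := by ring
      _ ≤ _ := h1
      _ = _ := by ring
  exact le_of_mul_le_mul_right this hmR

/-- the type of a sequence -/
noncomputable def cnt {X : Type*} {m : ℕ} (xs : Fin m → X) (x : X) : Fin (m + 1) := by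
  classical
  exact ⟨(Finset.univ.filter (fun i => xs i = x)).card,
    Nat.lt_succ_of_le ((Finset.card_le_univ _).trans (by simp))⟩

/-- the distribution of a type -/
noncomputable def pt {X : Type*} {m : ℕ} (t : X → Fin (m + 1)) (x : X) : ℝ :=
  ((t x : ℕ) : ℝ) / m

lemma sum_cnt {X : Type*} [Fintype X] {m : ℕ} (xs : Fin m → X) (φ : X → ℝ) :
    ∑ i, φ (xs i) = ∑ x, ((cnt xs x : ℕ) : ℝ) * φ x := by
  classical
  have : ∀ i, φ (xs i) = ∑ x, if xs i = x then φ x else 0 := fun i => by simp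
  rw [Finset.sum_congr rfl (fun i _ => this i), Finset.sum_comm]
  apply Finset.sum_congr rfl
  intro x _
  rw [← Finset.sum_filter, Finset.sum_const, nsmul_eq_mul]
  congr 2

/-- universal output distribution -/
noncomputable def quni {X Y : Type*} [Fintype X] (N : X → Y → ℝ) (m : ℕ)
    (ys : Fin m → Y) : ℝ := by
  classical
  exact (((m + 1 : ℝ)) ^ (Fintype.card X))⁻¹ * ∑ t : X → Fin (m + 1),
    if ∑ x, (t x : ℕ) = m then ∏ i, outp N (pt t) (ys i) else 0

lemma pt_nonneg {X : Type*} {m : ℕ} (t : X → Fin (m + 1)) (x : X) : 0 ≤ pt t x := by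
  unfold pt; positivity

lemma pt_sum {X : Type*} [Fintype X] {m : ℕ} (hm : 0 < m) (t : X → Fin (m + 1))
    (h : ∑ x, (t x : ℕ) = m) : ∑ x, pt t x = 1 := by
  unfold pt
  rw [← Finset.sum_div, ← Nat.cast_sum, h]
  have : (m : ℝ) ≠ 0 := by exact_mod_cast hm.ne'
  field_simp

lemma outp_nonneg {X Y : Type*} [Fintype X] (N : X → Y → ℝ) (hN0 : ∀ x y, 0 ≤ N x y)
    (p : X → ℝ) (hp0 : ∀ x, 0 ≤ p x) (y : Y) : 0 ≤ outp N p y :=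
  Finset.sum_nonneg (fun x _ => mul_nonneg (hp0 x) (hN0 x y))

lemma quni_nonneg {X Y : Type*} [Fintype X] (N : X → Y → ℝ) (hN0 : ∀ x y, 0 ≤ N x y) (m : ℕ)
    (ys : Fin m → Y) : 0 ≤ quni N m ys := by
  classical
  unfold quni
  apply mul_nonneg (by positivity)
  apply Finset.sum_nonneg
  intro t _
  split_ifs
  · exact Finset.prod_nonneg (fun i _ => outp_nonneg N hN0 _ (pt_nonneg t) _)
  · exact le_rfl

lemma quni_sum {X Y : Type*} [Fintype X] [Fintype Y] (N : X → Y → ℝ)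
    (hN1 : ∀ x, ∑ y, N x y = 1) {m : ℕ} (hm : 0 < m) :
    ∑ ys, quni N m ys ≤ 1 := by
  classical
  unfold quni
  rw [← Finset.mul_sum, Finset.sum_comm]
  have hpos : (0:ℝ) < ((m + 1 : ℝ)) ^ (Fintype.card X) := by positivity
  rw [inv_mul_le_iff₀ hpos, mul_one]
  calc _ ≤ ∑ _t : X → Fin (m + 1), (1:ℝ) := by
        apply Finset.sum_le_sum
        intro t _
        by_cases h : ∑ x, (t x : ℕ) = m
        · simp only [h, if_true]
          have e2 : ∑ ys : Fin m → Y, ∏ i, outp N (pt t) (ys i)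
              = ∏ i : Fin m, ∑ y, outp N (pt t) y := by
            rw [Finset.prod_univ_sum]; simp
          have e3 : ∑ y, outp N (pt t) y = 1 := by
            unfold outp
            rw [Finset.sum_comm]
            simp only [← Finset.mul_sum, hN1, mul_one]
            exact pt_sum hm t h
          rw [e2, e3]; simp
        · simp [h]
    _ = _ := by simp

lemma quni_ge {X Y : Type*} [Fintype X] (N : X → Y → ℝ) (hN0 : ∀ x y, 0 ≤ N x y) {m : ℕ}
    (t : X → Fin (m + 1)) (h : ∑ x, (t x : ℕ) = m) (ys : Fin m → Y) :
    ∏ i, outp N (pt t) (ys i) ≤ ((m + 1 : ℝ)) ^ (Fintype.card X) * quni N m ys := by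
  classical
  unfold quni
  have hpos : (0:ℝ) < ((m + 1 : ℝ)) ^ (Fintype.card X) := by positivity
  rw [mul_inv_cancel_left₀ hpos.ne']
  have := Finset.single_le_sum (f := fun t : X → Fin (m + 1) =>
    if ∑ x, (t x : ℕ) = m then ∏ i, outp N (pt t) (ys i) else 0)
    (fun t _ => by
      split_ifs
      · exact Finset.prod_nonneg (fun i _ => outp_nonneg N hN0 _ (pt_nonneg t) _)
      · exact le_rfl) (Finset.mem_univ t)
  simpa [h] using this

lemma good_bound {X Y : Type*} [Fintype X] (N : X → Y → ℝ) (hN0 : ∀ x y, 0 ≤ N x y)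
    {m : ℕ} (hm : 0 < m) (xs : Fin m → X) (ys : Fin m → Y) (h : ∑ x, (cnt xs x : ℕ) = m) (B : ℝ)
    (hb : (∀ i, 0 < N (xs i) (ys i)) → ∑ i, dens N (pt (cnt xs)) (xs i) (ys i) ≤ B) :
    ∏ i, N (xs i) (ys i) ≤ Real.exp B * ((m + 1 : ℝ)) ^ (Fintype.card X) * quni N m ys := by
  classical
  by_cases hpos : ∀ i, 0 < N (xs i) (ys i)
  · have hB := hb hpos
    have hmR : (0:ℝ) < m := by exact_mod_cast hm
    have hq : ∀ i, 0 < outp N (pt (cnt xs)) (ys i) := by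
      intro i
      have hpi : 0 < pt (cnt xs) (xs i) := by
        unfold pt
        apply div_pos _ hmR
        have : 0 < (Finset.univ.filter (fun j => xs j = xs i)).card :=
          Finset.card_pos.mpr ⟨i, by simp⟩
        unfold cnt
        simp only
        exact_mod_cast this
      refine lt_of_lt_of_le (mul_pos hpi (hpos i)) ?_
      exact Finset.single_le_sum (f := fun x => pt (cnt xs) x * N x (ys i))
        (fun x _ => mul_nonneg (pt_nonneg _ x) (hN0 x _)) (Finset.mem_univ (xs i))
    have e : ∏ i, N (xs i) (ys i) = Real.exp (∑ i, dens N (pt (cnt xs)) (xs i) (ys i)) *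
        ∏ i, outp N (pt (cnt xs)) (ys i) := by
      rw [Real.exp_sum, ← Finset.prod_mul_distrib]
      apply Finset.prod_congr rfl
      intro i _
      unfold dens
      rw [Real.exp_log (div_pos (hpos i) (hq i))]
      have := (hq i).ne'
      field_simp
    rw [e, mul_assoc]
    apply mul_le_mul (Real.exp_le_exp.mpr hB) (quni_ge N hN0 _ h ys)
      (Finset.prod_nonneg (fun i _ => (hq i).le)) (Real.exp_pos _).le
  · push Not at hpos
    obtain ⟨i, hi⟩ := hpos
    have : N (xs i) (ys i) = 0 := le_antisymm hi (hN0 _ _)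
    rw [Finset.prod_eq_zero (Finset.mem_univ i) this]
    have := quni_nonneg N hN0 m ys
    positivity

lemma eventually_poly (a : ℕ) (c d : ℝ) (hd : 0 < d) :
    ∀ᶠ m : ℕ in Filter.atTop, c * ((m : ℝ) + 1) ^ a ≤ Real.exp (m * d) := by
  have h1 : Filter.Tendsto (fun u : ℝ => Real.exp (d * u) / u ^ a) Filter.atTop Filter.atTop := by
    have := tendsto_exp_mul_div_rpow_atTop a d hd
    simpa using this
  have h2 : Filter.Tendsto (fun m : ℕ => (m : ℝ) + 1) Filter.atTop Filter.atTop :=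
    Filter.tendsto_atTop_add_const_right _ _ tendsto_natCast_atTop_atTop
  have h3 := (h1.comp h2).eventually_ge_atTop (c * Real.exp d)
  filter_upwards [h3] with m hm
  have hp : (0:ℝ) < ((m : ℝ) + 1) ^ a := by positivity
  simp only [Function.comp] at hm
  rw [le_div_iff₀ hp] at hm
  have e : Real.exp (d * ((m : ℝ) + 1)) = Real.exp (m * d) * Real.exp d := by
    rw [← Real.exp_add]; ring_nf
  rw [e] at hm
  have he := Real.exp_pos d
  nlinarith

end CRST

open CRST

/-- Classical reverse Shannon theorem, achievability. -/
theorem crst_direct {X Y : Type} [Fintype X] [Fintype Y]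
    (N : X → Y → ℝ) (hN0 : ∀ x y, 0 ≤ N x y) (hN1 : ∀ x, ∑ y, N x y = 1)
    (δ ε : ℝ) (hδ : 0 < δ) (hε : 0 < ε) :
    ∃ M₀ : ℕ, ∀ m, M₀ ≤ m →
      ∃ (K M : Type) (_ : Fintype K) (_ : Fintype M),
        0 < Fintype.card K ∧
        (Fintype.card M : ℝ) ≤ 2 ^ ((m : ℝ) * (capacity N + δ)) ∧
        ∃ (E : K → (Fin m → X) → M → ℝ) (D : K → M → (Fin m → Y) → ℝ),
          (∀ k xs j, 0 ≤ E k xs j) ∧ (∀ k xs, ∑ j, E k xs j = 1) ∧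
          (∀ k j ys, 0 ≤ D k j ys) ∧ (∀ k j, ∑ ys, D k j ys = 1) ∧
          ∀ xs : Fin m → X,
            (1/2) * ∑ ys : Fin m → Y,
              |((Fintype.card K : ℝ)⁻¹ * ∑ k, ∑ j, E k xs j * D k j ys)
                - ∏ i, N (xs i) (ys i)| ≤ ε := by
  classical
  rcases isEmpty_or_nonempty X with hX | hX
  · refine ⟨1, fun m hm => ⟨Unit, Empty, inferInstance, inferInstance, by simp, ?_,
      fun _ _ _ => 0, fun _ _ _ => 0, by simp, ?_, by simp, ?_, ?_⟩⟩
    · simp; positivity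
    · intro _ xs; exact (hX.false (xs ⟨0, hm⟩)).elim
    · intro _ j; exact j.elim
    · intro xs; exact (hX.false (xs ⟨0, hm⟩)).elim
  have hl : 0 < Real.log 2 := Real.log_pos (by norm_num)
  set d : ℝ := δ * Real.log 2 / 2 with hd
  have hdp : 0 < d := by positivity
  obtain ⟨R, hR, hRe⟩ : ∃ R : ℝ, 0 < R ∧ Real.exp (-R / 2) ≤ ε / 2 := by
    refine ⟨max 1 (-2 * Real.log (ε / 2)), by positivity, ?_⟩
    rw [← Real.le_log_iff_exp_le (by positivity)]
    have := le_max_right 1 (-2 * Real.log (ε / 2))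
    linarith
  set e1 : ℝ := min (ε / 2) (1 / 2) with he1
  have he1p : 0 < e1 := by positivity
  have ev1 := eventually_poly (Fintype.card X) (2 * (R + 1)) d hdp
  have ev2 : ∀ᶠ m : ℕ in Filter.atTop,
      4 * ((Fintype.card X : ℝ) + Fintype.card Y) / (e1 * d ^ 2) ≤ m :=
    tendsto_natCast_atTop_atTop.eventually_ge_atTop _
  obtain ⟨M₀, hM₀⟩ := Filter.eventually_atTop.mp (ev1.and (ev2.and (Filter.eventually_ge_atTop 1)))
  refine ⟨M₀, fun m hm => ?_⟩
  obtain ⟨hm1, hm2, hm3⟩ := hM₀ m hm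
  have hm0 : 0 < m := hm3
  have hmR : (0:ℝ) < m := by exact_mod_cast hm0
  have hcs : ∀ xs : Fin m → X, ∑ x, (cnt xs x : ℕ) = m := by
    intro xs
    have := sum_cnt xs (fun _ => (1:ℝ))
    simp at this
    exact_mod_cast this.symm
  set B : ℝ := m * (capacity N * Real.log 2 + d) with hB
  obtain ⟨K, M, iK, iM, hK, hM, E, D, hE0, hE1, hD0, hD1, hfin⟩ := oneshot
    (A := Fin m → X) (B := Fin m → Y) (fun xs ys => ∏ i, N (xs i) (ys i))
    (fun xs ys => Finset.prod_nonneg (fun i _ => hN0 _ _))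
    (fun xs => by
      have := (Finset.prod_univ_sum (fun _ : Fin m => (Finset.univ : Finset Y))
        (fun i y => N (xs i) y)).symm
      simpa [hN1] using this)
    (quni N m) (quni_nonneg N hN0 m) (quni_sum N hN1 hm0)
    (Real.exp B * ((m + 1 : ℝ)) ^ (Fintype.card X)) e1 R (by positivity) (min_le_right _ _) hR
    (fun xs ys => B < ∑ i, dens N (pt (cnt xs)) (xs i) (ys i))
    (fun xs ys h => good_bound N hN0 hm0 xs ys (hcs xs) B (fun _ => not_lt.mp h))
    (fun xs => by
      have hty : ∀ φ : X → ℝ, ∑ i, φ (xs i) = m * ∑ x, pt (cnt xs) x * φ x := by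
        intro φ
        rw [sum_cnt xs φ, Finset.mul_sum]
        apply Finset.sum_congr rfl
        intro x _
        unfold pt
        field_simp
      refine le_trans (chebyshev N hN0 hN1 hm0 (pt (cnt xs)) (pt_nonneg _)
        (pt_sum hm0 _ (hcs xs)) xs hty d hdp
        (fun ys => B < ∑ i, dens N (pt (cnt xs)) (xs i) (ys i)) (fun ys h => h)) ?_
      rw [div_le_iff₀ (by positivity)] at hm2 ⊢
      linarith)
  refine ⟨K, M, iK, iM, hK, hM.trans ?_, E, D, hE0, hE1, hD0, hD1, fun xs => (hfin xs).trans ?_⟩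
  · have e : (2:ℝ) ^ ((m : ℝ) * (capacity N + δ)) = Real.exp B * Real.exp (m * d) := by
      rw [Real.rpow_def_of_pos (by norm_num), ← Real.exp_add, hB, hd]
      ring_nf
    rw [e]
    calc _ = Real.exp B * (2 * (R + 1) * ((m:ℝ) + 1) ^ (Fintype.card X)) := by ring
      _ ≤ _ := by gcongr
  · have := min_le_left (ε / 2) (1 / 2)
    linarith
end

section
/- Classical reverse Shannon theorem, converse: Let N be a discrete memoryless channel from finite alphabet X to finite alphabet Y with Shannon capacity C(N), and let R ≥ 0. Suppose that for every ε > 0 there are infinitely many m for which there exist a finite randomness set K, a finite message set M with |M| ≤ 2^{mR}, and for each k ∈ K a stochastic encoder E_k (a conditional pmf on M given x^m ∈ X^m) and a stochastic decoder D_k (a conditional pmf on Y^m given j ∈ M), such that for every x^m ∈ X^m the simulated output distribution Ñ(y^m|x^m) = (1/|K|) Σ_{k∈K} Σ_{j∈M} E_k(j|x^m) D_k(y^m|j) satisfies (1/2) Σ_{y^m} |Ñ(y^m|x^m) − Π_{i=1}^m N(y_i|x_i)| ≤ ε. Then R ≥ C(N). -/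
open scoped BigOperators

lemma sum_prod_eq {S : Type*} [Fintype S] {m : ℕ} (f : Fin m → S → ℝ) :
    ∑ xs : Fin m → S, ∏ i, f i (xs i) = ∏ i, ∑ x, f i x := by
  classical
  rw [Finset.prod_univ_sum, Fintype.piFinset_univ]

/-- likelihood ratio -/
noncomputable def lr {X Y : Type} [Fintype X] (p : X → ℝ) (N : X → Y → ℝ) (x : X) (y : Y) : ℝ :=
  N x y / ∑ x', p x' * N x' y

lemma lr_nonneg {X Y : Type} [Fintype X] (p : X → ℝ) (N : X → Y → ℝ)
    (hp0 : ∀ x, 0 ≤ p x) (hN0 : ∀ x y, 0 ≤ N x y) (x : X) (y : Y) : 0 ≤ lr p N x y :=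
  div_nonneg (hN0 x y) (Finset.sum_nonneg fun x' _ => mul_nonneg (hp0 x') (hN0 x' y))

lemma sum_lr_le {X Y : Type} [Fintype X] (p : X → ℝ) (N : X → Y → ℝ) (y : Y) :
    ∑ x, p x * lr p N x y ≤ 1 := by
  unfold lr
  simp_rw [← mul_div_assoc]
  rw [← Finset.sum_div]
  exact div_self_le_one _

lemma lr_pos {X Y : Type} [Fintype X] (p : X → ℝ) (N : X → Y → ℝ)
    (hp0 : ∀ x, 0 ≤ p x) (hN0 : ∀ x y, 0 ≤ N x y) (x : X) (y : Y)
    (h : p x * N x y ≠ 0) : 0 < N x y ∧ 0 < p x ∧ 0 < ∑ x', p x' * N x' y := by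
  have h1 := left_ne_zero_of_mul h
  have h2 := right_ne_zero_of_mul h
  have hN := lt_of_le_of_ne (hN0 x y) h2.symm
  have hp := lt_of_le_of_ne (hp0 x) h1.symm
  refine ⟨hN, hp, lt_of_lt_of_le (mul_pos hp hN) ?_⟩
  exact Finset.single_le_sum (f := fun x' => p x' * N x' y)
    (fun x' _ => mul_nonneg (hp0 x') (hN0 x' y)) (Finset.mem_univ x)

lemma core {X Y : Type} [Fintype X] [Fintype Y]
    (N : X → Y → ℝ) (hN0 : ∀ x y, 0 ≤ N x y) (hN1 : ∀ x, ∑ y, N x y = 1)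
    (p : X → ℝ) (hp0 : ∀ x, 0 ≤ p x) (hp1 : ∑ x, p x = 1)
    (a s ε : ℝ) (hs : 0 ≤ s) (m : ℕ)
    (T : (Fin m → X) → (Fin m → Y) → ℝ) (Q : (Fin m → Y) → ℝ)
    (hQ0 : ∀ ys, 0 ≤ Q ys) (hTQ : ∀ xs ys, T xs ys ≤ Q ys)
    (hT : ∀ xs, (1/2) * ∑ ys, |T xs ys - ∏ i, N (xs i) (ys i)| ≤ ε) :
    1 ≤ 2 * ε + Real.exp (-(m * a)) * ∑ ys, Q ys +
      (∑ x, ∑ y, p x * N x y * Real.exp (s * (a - Real.log (lr p N x y)))) ^ m := by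
  have hpm0 : ∀ xs : Fin m → X, 0 ≤ ∏ i, p (xs i) := fun xs =>
    Finset.prod_nonneg fun i _ => hp0 _
  have key : ∀ (xs : Fin m → X) (ys : Fin m → Y),
      ∏ i, (p (xs i) * N (xs i) (ys i)) ≤
        (∏ i, p (xs i)) * |T xs ys - ∏ i, N (xs i) (ys i)|
        + Real.exp (-(m * a)) * (Q ys * ∏ i, (p (xs i) * lr p N (xs i) (ys i)))
        + ∏ i, (p (xs i) * N (xs i) (ys i) *
            Real.exp (s * (a - Real.log (lr p N (xs i) (ys i))))) := by
    intro xs ys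
    have hW0 : 0 ≤ ∏ i, lr p N (xs i) (ys i) :=
      Finset.prod_nonneg fun i _ => lr_nonneg p N hp0 hN0 _ _
    have h1 : 0 ≤ (∏ i, p (xs i)) * |T xs ys - ∏ i, N (xs i) (ys i)| :=
      mul_nonneg (hpm0 xs) (abs_nonneg _)
    have h3 : 0 ≤ ∏ i, (p (xs i) * N (xs i) (ys i) *
            Real.exp (s * (a - Real.log (lr p N (xs i) (ys i))))) :=
      Finset.prod_nonneg fun i _ =>
        mul_nonneg (mul_nonneg (hp0 _) (hN0 _ _)) (Real.exp_pos _).le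
    have h2 : 0 ≤ Real.exp (-(m * a)) * (Q ys * ∏ i, (p (xs i) * lr p N (xs i) (ys i))) := by
      rw [Finset.prod_mul_distrib]
      exact mul_nonneg (Real.exp_pos _).le (mul_nonneg (hQ0 _) (mul_nonneg (hpm0 _) hW0))
    rcases le_or_gt (Real.exp (m * a)) (∏ i, lr p N (xs i) (ys i)) with h | h
    · have e1 : 1 ≤ Real.exp (-(m * a)) * ∏ i, lr p N (xs i) (ys i) := by
        calc (1:ℝ) = Real.exp (-(m * a)) * Real.exp (m * a) := by
              rw [← Real.exp_add]; simp
          _ ≤ _ := mul_le_mul_of_nonneg_left h (Real.exp_pos _).le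
      have e2 : ∏ i, N (xs i) (ys i) ≤ |T xs ys - ∏ i, N (xs i) (ys i)| +
          Q ys * (Real.exp (-(m * a)) * ∏ i, lr p N (xs i) (ys i)) := by
        have := neg_abs_le (T xs ys - ∏ i, N (xs i) (ys i))
        have := hTQ xs ys
        have := le_mul_of_one_le_right (hQ0 ys) e1
        linarith
      have e3 := mul_le_mul_of_nonneg_left e2 (hpm0 xs)
      rw [Finset.prod_mul_distrib, Finset.prod_mul_distrib (f := fun i => p (xs i))]
      calc _ ≤ _ := e3
        _ = (∏ i, p (xs i)) * |T xs ys - ∏ i, N (xs i) (ys i)|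
        + Real.exp (-(m * a)) * (Q ys * ((∏ i, p (xs i)) * ∏ i, lr p N (xs i) (ys i))) := by ring
        _ ≤ _ := le_add_of_nonneg_right h3
    · refine le_trans ?_ (le_add_of_nonneg_left (add_nonneg h1 h2))
      by_cases hz : ∀ i, p (xs i) * N (xs i) (ys i) ≠ 0
      · have hl : ∀ i, 0 < lr p N (xs i) (ys i) := fun i => by
          obtain ⟨u, v, w⟩ := lr_pos p N hp0 hN0 _ _ (hz i)
          exact div_pos u w
        rw [Finset.prod_mul_distrib (g := fun i =>
          Real.exp (s * (a - Real.log (lr p N (xs i) (ys i)))))]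
        apply le_mul_of_one_le_right
        · exact Finset.prod_nonneg fun i _ => mul_nonneg (hp0 _) (hN0 _ _)
        rw [← Real.exp_sum, ← Finset.mul_sum]
        apply Real.one_le_exp
        apply mul_nonneg hs
        rw [Finset.sum_sub_distrib, ← Real.log_prod (fun i _ => (hl i).ne')]
        have := Real.log_le_log (Finset.prod_pos fun i _ => hl i) h.le
        rw [Real.log_exp] at this
        simp
        linarith
      · push Not at hz
        obtain ⟨i, hi⟩ := hz
        rw [Finset.prod_eq_zero (Finset.mem_univ i) hi]
        exact h3
  have hsum := Finset.sum_le_sum fun (xs : Fin m → X) (_ : xs ∈ Finset.univ) =>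
    Finset.sum_le_sum fun (ys : Fin m → Y) (_ : ys ∈ Finset.univ) => key xs ys
  simp only [Finset.sum_add_distrib] at hsum
  have dbl : ∀ f : X → Y → ℝ, ∑ xs : Fin m → X, ∑ ys : Fin m → Y, ∏ i, f (xs i) (ys i)
      = (∑ x, ∑ y, f x y) ^ m := by
    intro f
    have : ∀ xs : Fin m → X, ∑ ys : Fin m → Y, ∏ i, f (xs i) (ys i)
        = ∏ i, ∑ y, f (xs i) y := fun xs => sum_prod_eq (fun i y => f (xs i) y)
    simp_rw [this]
    rw [sum_prod_eq (fun (_ : Fin m) x => ∑ y, f x y)]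
    simp
  rw [dbl (fun x y => p x * N x y),
    dbl (fun x y => p x * N x y * Real.exp (s * (a - Real.log (lr p N x y))))] at hsum
  have l1 : ∑ x, ∑ y, p x * N x y = 1 := by
    simp_rw [← Finset.mul_sum, hN1]; simpa using hp1
  rw [l1, one_pow] at hsum
  refine hsum.trans (add_le_add (add_le_add ?_ ?_) le_rfl)
  · calc _ = ∑ xs : Fin m → X, (∏ i, p (xs i)) * ∑ ys, |T xs ys - ∏ i, N (xs i) (ys i)| := by
          simp_rw [Finset.mul_sum]
      _ ≤ ∑ xs : Fin m → X, (∏ i, p (xs i)) * (2 * ε) :=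
          Finset.sum_le_sum fun xs _ =>
            mul_le_mul_of_nonneg_left (by linarith [hT xs]) (hpm0 xs)
      _ = 2 * ε := by
          rw [← Finset.sum_mul, sum_prod_eq (fun (_ : Fin m) x => p x), hp1]; simp
  · rw [Finset.sum_comm]
    simp_rw [← Finset.mul_sum]
    refine mul_le_mul_of_nonneg_left (Finset.sum_le_sum fun ys _ => ?_) (Real.exp_pos _).le
    refine mul_le_of_le_one_right (hQ0 ys) ?_
    rw [sum_prod_eq (fun i x => p x * lr p N x (ys i))]
    exact Finset.prod_le_one
      (fun i _ => Finset.sum_nonneg fun x _ => mul_nonneg (hp0 x) (lr_nonneg p N hp0 hN0 _ _))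
      (fun i _ => sum_lr_le p N (ys i))

lemma mutInfo_eq {X Y : Type} [Fintype X] [Fintype Y]
    (N : X → Y → ℝ) (hN0 : ∀ x y, 0 ≤ N x y) (hN1 : ∀ x, ∑ y, N x y = 1)
    (p : X → ℝ) (hp0 : ∀ x, 0 ≤ p x) :
    mutInfo (fun z : X × Y => p z.1 * N z.1 z.2) * Real.log 2 =
      ∑ x, ∑ y, p x * N x y * Real.log (lr p N x y) := by
  have h2 : Real.log 2 ≠ 0 := (Real.log_pos one_lt_two).ne'
  have e : ∀ {S : Type} [Fintype S] (r : S → ℝ), shEnt r * Real.log 2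
      = - ∑ t, r t * Real.log (r t) := by
    intro S _ r
    unfold shEnt Real.logb
    rw [Finset.sum_mul, ← Finset.sum_neg_distrib]
    refine Finset.sum_congr rfl fun t _ => ?_
    field_simp
  unfold mutInfo
  rw [sub_mul, add_mul, e, e, e, Fintype.sum_prod_type]
  simp only [← Finset.mul_sum, hN1, mul_one]
  have a1 : ∑ x, p x * Real.log (p x) = ∑ x, ∑ y, p x * N x y * Real.log (p x) := by
    refine Finset.sum_congr rfl fun x _ => ?_
    rw [← Finset.sum_mul, ← Finset.mul_sum, hN1, mul_one]
  have a2 : ∑ y, (∑ x, p x * N x y) * Real.log (∑ x, p x * N x y)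
      = ∑ x, ∑ y, p x * N x y * Real.log (∑ x, p x * N x y) := by
    rw [Finset.sum_comm]
    exact Finset.sum_congr rfl fun y _ => Finset.sum_mul _ _ _
  rw [a1, a2, ← sub_eq_zero]
  simp only [← Finset.sum_neg_distrib, ← Finset.sum_add_distrib, ← Finset.sum_sub_distrib]
  refine Finset.sum_eq_zero fun x _ => Finset.sum_eq_zero fun y _ => ?_
  by_cases h : p x * N x y = 0
  · simp [h]
  obtain ⟨u, v, w⟩ := lr_pos p N hp0 hN0 _ _ h
  rw [lr, Real.log_div u.ne' w.ne', Real.log_mul v.ne' u.ne']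
  ring

/-- Chernoff: some positive tilt makes the moment generating function less than one. -/
lemma exists_tilt {X Y : Type} [Fintype X] [Fintype Y] (P L : X → Y → ℝ)
    (hP : ∑ x, ∑ y, P x y = 1) (a : ℝ) (ha : a < ∑ x, ∑ y, P x y * L x y) :
    ∃ s > 0, ∑ x, ∑ y, P x y * Real.exp (s * (a - L x y)) < 1 := by
  have hd : HasDerivAt (fun s : ℝ => ∑ x, ∑ y, P x y * Real.exp (s * (a - L x y)))
      (∑ x, ∑ y, P x y * (a - L x y)) 0 := by
    refine HasDerivAt.fun_sum fun x _ => HasDerivAt.fun_sum fun y _ => ?_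
    have := (((hasDerivAt_id (0:ℝ)).mul_const (a - L x y)).exp).const_mul (P x y)
    simpa using this
  have hneg : ∑ x, ∑ y, P x y * (a - L x y) < 0 := by
    simp only [mul_sub, Finset.sum_sub_distrib, ← Finset.sum_mul, hP]
    linarith
  have h := (hasDerivAt_iff_tendsto_slope.1 hd).mono_left
    (nhdsWithin_mono 0 (fun s (hs : 0 < s) => ne_of_gt hs) :
      nhdsWithin (0:ℝ) (Set.Ioi 0) ≤ _)
  have h2 := (h.eventually (gt_mem_nhds hneg)).and self_mem_nhdsWithin
  obtain ⟨s, hs, hs0⟩ := h2.exists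
  have hs0 : 0 < s := hs0
  refine ⟨s, hs0, ?_⟩
  rw [slope_def_field, sub_zero, div_lt_iff₀ hs0, zero_mul] at hs
  simpa [hP, sub_neg] using hs

/-- Classical reverse Shannon theorem, converse. -/
theorem crst_converse {X Y : Type} [Fintype X] [Fintype Y]
    (N : X → Y → ℝ) (hN0 : ∀ x y, 0 ≤ N x y) (hN1 : ∀ x, ∑ y, N x y = 1)
    (R : ℝ) (hR : 0 ≤ R)
    (hsim : ∀ ε > (0:ℝ), ∀ m₀ : ℕ, ∃ m, m₀ ≤ m ∧
      ∃ (K M : Type) (_ : Fintype K) (_ : Fintype M),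
        0 < Fintype.card K ∧
        (Fintype.card M : ℝ) ≤ 2 ^ ((m : ℝ) * R) ∧
        ∃ (E : K → (Fin m → X) → M → ℝ) (D : K → M → (Fin m → Y) → ℝ),
          (∀ k xs j, 0 ≤ E k xs j) ∧ (∀ k xs, ∑ j, E k xs j = 1) ∧
          (∀ k j ys, 0 ≤ D k j ys) ∧ (∀ k j, ∑ ys, D k j ys = 1) ∧
          ∀ xs : Fin m → X,
            (1/2) * ∑ ys : Fin m → Y,
              |((Fintype.card K : ℝ)⁻¹ * ∑ k, ∑ j, E k xs j * D k j ys)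
                - ∏ i, N (xs i) (ys i)| ≤ ε) :
    R ≥ capacity N := by

  have h2 : 0 < Real.log 2 := Real.log_pos one_lt_two
  refine Real.sSup_le ?_ hR
  rintro c ⟨p, hp0, hp1, rfl⟩
  by_contra! hlt
  obtain ⟨b, hb1, hb2⟩ := exists_between hlt
  have hP : ∑ x, ∑ y, p x * N x y = 1 := by
    simp_rw [← Finset.mul_sum, hN1]; simpa using hp1
  obtain ⟨s, hs, hg⟩ := exists_tilt (fun x y => p x * N x y)
    (fun x y => Real.log (lr p N x y)) hP (b * Real.log 2) (by
      rw [← mutInfo_eq N hN0 hN1 p hp0]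
      exact mul_lt_mul_of_pos_right hb2 h2)
  have hg0 : 0 ≤ ∑ x, ∑ y, p x * N x y *
      Real.exp (s * (b * Real.log 2 - Real.log (lr p N x y))) :=
    Finset.sum_nonneg fun x _ => Finset.sum_nonneg fun y _ =>
      mul_nonneg (mul_nonneg (hp0 _) (hN0 _ _)) (Real.exp_pos _).le
  have ht1 := tendsto_pow_atTop_nhds_zero_of_lt_one hg0 hg
  have hr1 : Real.exp ((R - b) * Real.log 2) < 1 :=
    Real.exp_lt_one_iff.2 (mul_neg_of_neg_of_pos (by linarith) h2)
  have ht2 := tendsto_pow_atTop_nhds_zero_of_lt_one (Real.exp_pos _).le hr1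
  have q4 : (0:ℝ) < 1/4 := by norm_num
  obtain ⟨m₀, hm₀⟩ := Filter.eventually_atTop.1
    ((ht1.eventually (gt_mem_nhds q4)).and (ht2.eventually (gt_mem_nhds q4)))
  obtain ⟨m, hm, K, M, _, _, hK, hM, E, D, hE0, hE1, hD0, hD1, hsm⟩ := hsim (1/8) (by norm_num) m₀
  obtain ⟨hA, hB⟩ := hm₀ m hm
  have hK' : (0:ℝ) < Fintype.card K := by exact_mod_cast hK
  have hE : ∀ k xs j, E k xs j ≤ 1 := fun k xs j => by
    rw [← hE1 k xs]
    exact Finset.single_le_sum (fun j _ => hE0 k xs j) (Finset.mem_univ j)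
  have hc := core N hN0 hN1 p hp0 hp1 (b * Real.log 2) s (1/8) hs.le m
    (fun xs ys => (Fintype.card K : ℝ)⁻¹ * ∑ k, ∑ j, E k xs j * D k j ys)
    (fun ys => (Fintype.card K : ℝ)⁻¹ * ∑ k, ∑ j, D k j ys)
    (fun ys => mul_nonneg (inv_nonneg.2 hK'.le)
      (Finset.sum_nonneg fun k _ => Finset.sum_nonneg fun j _ => hD0 k j ys))
    (fun xs ys => mul_le_mul_of_nonneg_left
      (Finset.sum_le_sum fun k _ => Finset.sum_le_sum fun j _ =>
        mul_le_of_le_one_left (hD0 k j ys) (hE k xs j)) (inv_nonneg.2 hK'.le)) hsm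
  have hQ : ∑ ys : Fin m → Y, (Fintype.card K : ℝ)⁻¹ * ∑ k, ∑ j, D k j ys
      = Fintype.card M := by
    rw [← Finset.mul_sum, Finset.sum_comm]
    have : ∀ k, ∑ ys : Fin m → Y, ∑ j, D k j ys = Fintype.card M := fun k => by
      rw [Finset.sum_comm]; simp [hD1]
    simp only [this, Finset.sum_const, Finset.card_univ, nsmul_eq_mul]
    field_simp
  rw [hQ] at hc
  have hfin : Real.exp (-(m * (b * Real.log 2))) * (Fintype.card M : ℝ)
      ≤ Real.exp ((R - b) * Real.log 2) ^ m := by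
    refine (mul_le_mul_of_nonneg_left hM (Real.exp_pos _).le).trans (le_of_eq ?_)
    rw [Real.rpow_def_of_pos two_pos, ← Real.exp_add, ← Real.exp_nat_mul]
    congr 1
    ring
  linarith
end
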